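/- (Proposition 1, convergence part) Let L, U : S → A → ℝ satisfy L(s,a) ≤ Q*(s,a) ≤ U(s,a) for all (s,a), and define the clipped Bellman operator B_C by (B_C Q)(s,a) = max( min( (B Q)(s,a), U(s,a) ), L(s,a) ). Then for every Q : S → A → ℝ, the iterates B_C^n Q converge uniformly to Q* as n → ∞; in particular Q* is the unique fixed point of B_C, and B_C and B have the same fixed point. -/

import Mathlib

open Real Filter

/-- The soft (entropy-regularized) Bellman operator for a finite MDP. -/
noncomputable def softBellman {S A : Type*} [Fintype S] [Fintype A]
    (p : S → A → PMF S) (r : S → A → ℝ) (γ β : ℝ) (π0 : S → PMF A)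
    (Q : S → A → ℝ) : S → A → ℝ :=
  fun s a => r s a + (γ / β) * ∑ s' : S, (p s a s').toReal *
      Real.log (∑ a' : A, (π0 s' a').toReal * Real.exp (β * Q s' a'))

/-- The clipped soft Bellman operator with lower bound `L` and upper bound `U`. -/
noncomputable def clippedBellman {S A : Type*} [Fintype S] [Fintype A]
    (p : S → A → PMF S) (r : S → A → ℝ) (γ β : ℝ) (π0 : S → PMF A)
    (L U : S → A → ℝ) (Q : S → A → ℝ) : S → A → ℝ :=
  fun s a => max (min (softBellman p r γ β π0 Q s a) (U s a)) (L s a)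

lemma pmf_sum_toReal {T : Type*} [Fintype T] (q : PMF T) : ∑ t, (q t).toReal = 1 := by
  have h := q.tsum_coe
  rw [tsum_fintype] at h
  rw [← ENNReal.toReal_sum (fun t _ => q.apply_ne_top t), h]
  simp

lemma softBellman_le {S A : Type*} [Fintype S] [Fintype A] [Nonempty A]
    (p : S → A → PMF S) (r : S → A → ℝ) (γ β : ℝ) (π0 : S → PMF A)
    (hγ0 : 0 ≤ γ) (hβ : 0 < β) (hπ0 : ∀ s a, 0 < π0 s a)
    (Q Q' : S → A → ℝ) (C : ℝ) (h : ∀ s a, Q s a ≤ Q' s a + C) (s : S) (a : A) :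
    softBellman p r γ β π0 Q s a ≤ softBellman p r γ β π0 Q' s a + γ * C := by
  have hpos : ∀ s a, 0 < (π0 s a).toReal := fun s a =>
    ENNReal.toReal_pos (hπ0 s a).ne' ((π0 s).apply_ne_top a)
  have hsum : ∀ (Q : S → A → ℝ) s', 0 < ∑ a' : A, (π0 s' a').toReal * Real.exp (β * Q s' a') :=
    fun Q s' => Finset.sum_pos (fun a' _ => mul_pos (hpos s' a') (Real.exp_pos _))
      Finset.univ_nonempty
  have hlog : ∀ s', Real.log (∑ a' : A, (π0 s' a').toReal * Real.exp (β * Q s' a')) ≤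
      Real.log (∑ a' : A, (π0 s' a').toReal * Real.exp (β * Q' s' a')) + β * C := by
    intro s'
    rw [← Real.log_exp (β * C), ← Real.log_mul (hsum Q' s').ne' (Real.exp_pos _).ne']
    apply Real.log_le_log (hsum Q s')
    rw [Finset.sum_mul]
    apply Finset.sum_le_sum
    intro a' _
    rw [mul_assoc, ← Real.exp_add]
    apply mul_le_mul_of_nonneg_left _ (hpos s' a').le
    apply Real.exp_le_exp.2
    have := mul_le_mul_of_nonneg_left (h s' a') hβ.le
    linarith
  have h1 : ∑ s' : S, (p s a s').toReal *
      Real.log (∑ a' : A, (π0 s' a').toReal * Real.exp (β * Q s' a')) ≤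
      ∑ s' : S, (p s a s').toReal *
      Real.log (∑ a' : A, (π0 s' a').toReal * Real.exp (β * Q' s' a')) + β * C := by
    calc _ ≤ ∑ s' : S, (p s a s').toReal * (Real.log (∑ a' : A, (π0 s' a').toReal *
            Real.exp (β * Q' s' a')) + β * C) :=
          Finset.sum_le_sum fun s' _ => mul_le_mul_of_nonneg_left (hlog s') ENNReal.toReal_nonneg
      _ = _ := by
          simp only [mul_add, Finset.sum_add_distrib]
          rw [← Finset.sum_mul, pmf_sum_toReal, one_mul]
  have h2 := mul_le_mul_of_nonneg_left h1 (div_nonneg hγ0 hβ.le)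
  have h3 : γ / β * (β * C) = γ * C := by field_simp
  rw [mul_add, h3] at h2
  unfold softBellman
  linarith

/-- Proposition 1 (convergence part): if `L ≤ Q* ≤ U`, then for every `Q` the iterates
of the clipped Bellman operator converge uniformly to `Q*`; in particular `Q*` is the
unique fixed point of `B_C`, so `B_C` and `B` have the same fixed point. -/
theorem clippedBellman_convergence
    {S A : Type*} [Fintype S] [Fintype A] [Nonempty S] [Nonempty A]
    (p : S → A → PMF S) (r : S → A → ℝ) (γ β : ℝ) (π0 : S → PMF A)
    (hγ0 : 0 ≤ γ) (hγ1 : γ < 1) (hβ : 0 < β)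
    (hπ0 : ∀ s a, 0 < π0 s a)
    (Qstar : S → A → ℝ) (hfix : softBellman p r γ β π0 Qstar = Qstar)
    (L U : S → A → ℝ)
    (hL : ∀ s a, L s a ≤ Qstar s a) (hU : ∀ s a, Qstar s a ≤ U s a) :
    (∀ Q : S → A → ℝ,
      Tendsto
        (fun n => ⨆ x : S × A,
          |(clippedBellman p r γ β π0 L U)^[n] Q x.1 x.2 - Qstar x.1 x.2|)
        atTop (nhds 0)) ∧
    clippedBellman p r γ β π0 L U Qstar = Qstar ∧
    (∀ Q : S → A → ℝ, clippedBellman p r γ β π0 L U Q = Q → Q = Qstar) := by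
  have hstar : clippedBellman p r γ β π0 L U Qstar = Qstar := by
    funext s a
    unfold clippedBellman
    rw [hfix, min_eq_left (hU s a), max_eq_left (hL s a)]
  have hstep : ∀ (Q : S → A → ℝ) (C : ℝ), (∀ s a, |Q s a - Qstar s a| ≤ C) →
      ∀ s a, |clippedBellman p r γ β π0 L U Q s a - Qstar s a| ≤ γ * C := by
    intro Q C hC s a
    have hC0 : 0 ≤ C := (abs_nonneg _).trans (hC s a)
    have hgC : 0 ≤ γ * C := mul_nonneg hγ0 hC0
    have u := softBellman_le p r γ β π0 hγ0 hβ hπ0 Q Qstar C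
      (fun s a => by linarith [(abs_le.1 (hC s a)).2]) s a
    have l := softBellman_le p r γ β π0 hγ0 hβ hπ0 Qstar Q C
      (fun s a => by linarith [(abs_le.1 (hC s a)).1]) s a
    rw [hfix] at u l
    have := hL s a
    have := hU s a
    unfold clippedBellman
    rw [abs_le]
    constructor
    · have : Qstar s a - γ * C ≤ min (softBellman p r γ β π0 Q s a) (U s a) :=
        le_min (by linarith) (by linarith)
      linarith [le_max_left (min (softBellman p r γ β π0 Q s a) (U s a)) (L s a)]
    · have : max (min (softBellman p r γ β π0 Q s a) (U s a)) (L s a) ≤ Qstar s a + γ * C :=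
        max_le ((min_le_left _ _).trans u) (by linarith)
      linarith
  have hconv : ∀ Q : S → A → ℝ,
      Tendsto
        (fun n => ⨆ x : S × A,
          |(clippedBellman p r γ β π0 L U)^[n] Q x.1 x.2 - Qstar x.1 x.2|)
        atTop (nhds 0) := by
    intro Q
    obtain ⟨C, hC⟩ : ∃ C, ∀ s a, |Q s a - Qstar s a| ≤ C := by
      obtain ⟨C, hC⟩ := (Set.finite_range
        (fun x : S × A => |Q x.1 x.2 - Qstar x.1 x.2|)).bddAbove
      exact ⟨C, fun s a => hC ⟨(s, a), rfl⟩⟩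
    have hn : ∀ n s a, |(clippedBellman p r γ β π0 L U)^[n] Q s a - Qstar s a| ≤ γ ^ n * C := by
      intro n
      induction n with
      | zero => simpa using hC
      | succ n ih =>
        intro s a
        rw [Function.iterate_succ_apply', pow_succ', mul_assoc]
        exact hstep _ _ ih s a
    have hlim : Tendsto (fun n : ℕ => γ ^ n * C) atTop (nhds 0) := by
      simpa using (tendsto_pow_atTop_nhds_zero_of_lt_one hγ0 hγ1).mul_const C
    exact squeeze_zero (fun n => Real.iSup_nonneg fun x => abs_nonneg _)
      (fun n => ciSup_le fun x => hn n x.1 x.2) hlim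
  refine ⟨hconv, hstar, fun Q hQ => ?_⟩
  have h := hconv Q
  simp only [Function.iterate_fixed hQ] at h
  have h0 := tendsto_nhds_unique tendsto_const_nhds h
  funext s a
  have h1 := le_ciSup (Set.finite_range
        (fun x : S × A => |Q x.1 x.2 - Qstar x.1 x.2|)).bddAbove (s, a)
  rw [h0] at h1
  exact sub_eq_zero.1 (abs_nonpos_iff.1 h1)
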